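/- (Proposition 1, exact derivative form of the von Mises expansion.) Let g ≥ 1 be a natural number, μ ∈ ℝ, σ > 0, t ∈ ℝ, and let F be any Borel probability measure on ℝ. For ε ∈ [0,1] set F_ε = (1−ε)·Φ_{μ,σ} + ε·F. Then the function h(ε) = P_{F_ε^{⊗g}}( Σ_{i=1}^g ((Z_i−μ)/σ)² > t ) is differentiable at ε = 0 with h′(0) = g·∫_ℝ P( χ²_{g−1} > t − ((x−μ)/σ)² ) dF(x) − g·P( χ²_g > t ); consequently the first-order expansion at ε = 1 is g·∫_ℝ P(χ²_{g−1} > t − ((x−μ)/σ)²) dF(x) − (g−1)·P(χ²_g > t). -/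

import Mathlib

open MeasureTheory ProbabilityTheory

/-- The chi-square distribution with `m` degrees of freedom, i.e. the gamma distribution with
shape `m/2` and rate `1/2`, with the convention that `χ²₀` is the Dirac mass at `0`. -/
noncomputable def chiSqMeasure (m : ℕ) : Measure ℝ :=
  if m = 0 then Measure.dirac 0 else gammaMeasure ((m : ℝ) / 2) (1 / 2)

/-- Two finite measures on `ℝ` whose moment generating functions agree and do not vanish on a
half-line `(-∞, c)` with `0 < c` are equal. -/
theorem ext_of_mgf_eq_of_lt {μ ν : Measure ℝ} [IsFiniteMeasure μ] [IsFiniteMeasure ν] {c : ℝ}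
    (hc : 0 < c) (h : ∀ s < c, mgf id μ s = mgf id ν s) (h₀ : ∀ s < c, mgf id ν s ≠ 0) :
    μ = ν := by
  have interior_of (ρ : Measure ℝ) (hρ : ∀ s < c, mgf id ρ s ≠ 0) :
      Set.Iio c ⊆ interior (integrableExpSet id ρ) :=
    interior_maximal (fun s hs => Integrable.of_integral_ne_zero (hρ s hs)) isOpen_Iio
  have hμ : AnalyticOnNhd ℂ (complexMGF id μ) {z | z.re < c} := fun z hz =>
    analyticAt_complexMGF (interior_of μ (fun s hs => by rw [h s hs]; exact h₀ s hs) hz)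
  have hν : AnalyticOnNhd ℂ (complexMGF id ν) {z | z.re < c} := fun z hz =>
    analyticAt_complexMGF (interior_of ν h₀ hz)
  have key : Set.EqOn (complexMGF id μ) (complexMGF id ν) {z | z.re < c} := by
    refine AnalyticOnNhd.eqOn_of_preconnected_of_frequently_eq hμ hν
      (convex_halfSpace_re_lt c).isPreconnected (z₀ := ((0 : ℝ) : ℂ)) (by simpa using hc) ?_
    have h_real : ∀ᶠ x : ℝ in nhdsWithin 0 {0}ᶜ, complexMGF id μ x = complexMGF id ν x := by
      filter_upwards [mem_nhdsWithin_of_mem_nhds (Iio_mem_nhds hc)] with x hx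
      rw [complexMGF_ofReal, complexMGF_ofReal, h x hx]
    refine Filter.Tendsto.frequently (f := ((↑) : ℝ → ℂ)) ?_ h_real.frequently
    refine tendsto_nhdsWithin_iff.2
      ⟨(Complex.continuous_ofReal.tendsto 0).mono_left nhdsWithin_le_nhds, ?_⟩
    filter_upwards [self_mem_nhdsWithin] with x hx
    simpa using hx
  refine Measure.ext_of_charFun (funext fun s => ?_)
  rw [← complexMGF_id_mul_I, ← complexMGF_id_mul_I]
  exact key (by simpa using hc)

theorem mgf_id_gammaMeasure {a r s : ℝ} (ha : 0 < a) (hr : 0 < r) (hs : s < r) :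
    mgf id (gammaMeasure a r) s = (r / (r - s)) ^ a := by
  have hrs : 0 < r - s := sub_pos.2 hs
  have hind : ∀ x : ℝ, (gammaPDF a r x).toReal • Real.exp (s * x) =
      (Set.Ici (0 : ℝ)).indicator
        (fun x => r ^ a / Real.Gamma a * (x ^ (a - 1) * Real.exp (-((r - s) * x)))) x := by
    intro x
    rw [gammaPDF, ENNReal.toReal_ofReal (gammaPDFReal_nonneg ha hr x), gammaPDFReal]
    by_cases hx : 0 ≤ x
    · rw [if_pos hx, Set.indicator_of_mem (Set.mem_Ici.2 hx), smul_eq_mul, mul_assoc, mul_assoc,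
        ← Real.exp_add]
      ring_nf
    · rw [if_neg hx, Set.indicator_of_notMem (by simpa using hx), zero_smul]
  simp only [mgf, id]
  rw [gammaMeasure, integral_withDensity_eq_integral_toReal_smul
    (f := gammaPDF a r) (measurable_gammaPDFReal a r).ennreal_ofReal (ae_of_all _ fun _ => ENNReal.ofReal_lt_top)]
  simp_rw [hind]
  rw [integral_indicator measurableSet_Ici, integral_Ici_eq_integral_Ioi, integral_const_mul,
    Real.integral_rpow_mul_exp_neg_mul_Ioi ha hrs, Real.div_rpow zero_le_one hrs.le,
    Real.div_rpow hr.le hrs.le, Real.one_rpow]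
  have := (Real.Gamma_pos_of_pos ha).ne'
  field_simp

theorem mgf_sq_gaussianReal {s : ℝ} (hs : s < 1 / 2) :
    ∫ y, Real.exp (s * y ^ 2) ∂(gaussianReal 0 1) = (1 / 2 / (1 / 2 - s)) ^ (1 / 2 : ℝ) := by
  have hs' : 0 < 1 / 2 - s := sub_pos.2 hs
  rw [integral_gaussianReal_eq_integral_smul one_ne_zero]
  have : ∀ y : ℝ, gaussianPDFReal 0 1 y • Real.exp (s * y ^ 2) =
      (√(2 * Real.pi))⁻¹ * Real.exp (-(1 / 2 - s) * y ^ 2) := by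
    intro y
    simp only [gaussianPDFReal, NNReal.coe_one, mul_one, sub_zero, smul_eq_mul]
    rw [mul_assoc, ← Real.exp_add]
    ring_nf
  simp_rw [this]
  rw [integral_const_mul, integral_gaussian, ← Real.sqrt_eq_rpow, ← Real.sqrt_inv,
    ← Real.sqrt_mul (by positivity)]
  congr 1
  field_simp

instance isProbabilityMeasure_chiSqMeasure (m : ℕ) : IsProbabilityMeasure (chiSqMeasure m) := by
  unfold chiSqMeasure
  split_ifs with h
  · infer_instance
  · exact isProbabilityMeasure_gammaMeasure (by positivity) (by norm_num)

theorem mgf_id_chiSqMeasure (m : ℕ) {s : ℝ} (hs : s < 1 / 2) :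
    mgf id (chiSqMeasure m) s = ((1 / 2 / (1 / 2 - s)) ^ (1 / 2 : ℝ)) ^ m := by
  have hs' : 0 < 1 / 2 - s := sub_pos.2 hs
  unfold chiSqMeasure
  split_ifs with h
  · simp [h, mgf]
  · rw [mgf_id_gammaMeasure (by positivity) (by norm_num) hs, ← Real.rpow_mul_natCast (by positivity)]
    ring_nf

theorem gaussianReal_map_standardize (μ : ℝ) {σ : ℝ} (hσ : 0 < σ) {v : NNReal}
    (hv : (v : ℝ) = σ ^ 2) :
    (gaussianReal μ v).map (fun x => (x - μ) / σ) = gaussianReal 0 1 := by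
  have : (fun x => (x - μ) / σ) = (fun x => x / σ) ∘ (fun x => x - μ) := rfl
  rw [this, ← Measure.map_map (by fun_prop) (by fun_prop), gaussianReal_map_sub_const,
    gaussianReal_map_div_const, sub_self, zero_div]
  congr 1
  ext
  have : σ ^ 2 ≠ 0 := by positivity
  simp [hv, this]

/-- The sum of the squares of `m` independent standardized Gaussian variables has the chi-square
distribution with `m` degrees of freedom. -/
theorem map_sum_sq_pi_gaussianReal (m : ℕ) (μ : ℝ) {σ : ℝ} (hσ : 0 < σ) {v : NNReal}
    (hv : (v : ℝ) = σ ^ 2) :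
    (Measure.pi fun _ : Fin m => gaussianReal μ v).map
      (fun z => ∑ i, ((z i - μ) / σ) ^ 2) = chiSqMeasure m := by
  have hmeas : Measurable fun z : Fin m → ℝ => ∑ i, ((z i - μ) / σ) ^ 2 := by fun_prop
  have := Measure.isProbabilityMeasure_map
    (μ := Measure.pi fun _ : Fin m => gaussianReal μ v) hmeas.aemeasurable
  refine ext_of_mgf_eq_of_lt (c := 1 / 2) (by norm_num) (fun s hs => ?_) (fun s hs => ?_)
  · rw [mgf_id_chiSqMeasure m hs, mgf_id_map hmeas.aemeasurable]
    simp only [mgf, Finset.mul_sum, Real.exp_sum]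
    rw [integral_fintype_prod_eq_pow (fun x => Real.exp (s * ((x - μ) / σ) ^ 2)),
      Fintype.card_fin, ← mgf_sq_gaussianReal hs, ← gaussianReal_map_standardize μ hσ hv,
      integral_map (by fun_prop) (by fun_prop)]
  · rw [mgf_id_chiSqMeasure m hs]
    have : 0 < 1 / 2 - s := sub_pos.2 hs
    positivity

/-- Multinomial expansion of a power of a mixture of two measures. -/
theorem pi_smul_add_smul {ι α : Type*} [Fintype ι] [DecidableEq ι] [MeasurableSpace α]
    (P Q : Measure α) [IsFiniteMeasure P] [IsFiniteMeasure Q] {a b : ENNReal} (ha : a ≠ ⊤)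
    (hb : b ≠ ⊤) :
    Measure.pi (fun _ : ι => a • P + b • Q) =
      ∑ s : Finset ι, (b ^ s.card * a ^ (Fintype.card ι - s.card)) •
        Measure.pi (fun i => if i ∈ s then Q else P) := by
  have hP : IsFiniteMeasure (a • P) := Measure.smul_finite P ha
  have hQ : IsFiniteMeasure (b • Q) := Measure.smul_finite Q hb
  have hPQ (s : Finset ι) (i : ι) : IsFiniteMeasure (if i ∈ s then Q else P) := by
    split_ifs <;> infer_instance
  refine Measure.pi_eq fun B _ => ?_
  simp only [Measure.finsetSum_apply, Measure.smul_apply, Measure.add_apply, smul_eq_mul,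
    Measure.pi_pi]
  simp_rw [add_comm (a * P _)]
  rw [Finset.prod_add, Finset.powerset_univ]
  refine Finset.sum_congr rfl fun s _ => ?_
  rw [← Finset.compl_eq_univ_sdiff, Finset.prod_mul_distrib, Finset.prod_mul_distrib,
    Finset.prod_const, Finset.prod_const, Finset.card_compl, mul_mul_mul_comm]
  congr 1
  rw [← Finset.prod_mul_prod_compl s]
  congr 1
  · exact Finset.prod_congr rfl fun i hi => by rw [if_pos hi]
  · exact Finset.prod_congr rfl fun i hi => by rw [if_neg (Finset.mem_compl.1 hi)]

theorem hasDerivAt_pow_mul_one_sub_pow (k m : ℕ) :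
    HasDerivAt (fun ε : ℝ => ε ^ k * (1 - ε) ^ m)
      ((if k = 1 then 1 else 0) - (if k = 0 then (m : ℝ) else 0)) 0 := by
  have h := (hasDerivAt_pow k (0 : ℝ)).mul (((hasDerivAt_id (0 : ℝ)).const_sub 1).pow m)
  refine h.congr_deriv ?_
  rcases k with _ | _ | k <;> simp

/-- The first-order influence of a contamination on the probability of an event under a product
measure. -/
theorem hasDerivWithinAt_pi_mixture {ι α : Type*} [Fintype ι] [DecidableEq ι] [MeasurableSpace α]
    (P Q : Measure α) [IsProbabilityMeasure P] [IsProbabilityMeasure Q] (A : Set (ι → α)) :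
    HasDerivWithinAt
      (fun ε : ℝ => ((Measure.pi fun _ : ι => ENNReal.ofReal (1 - ε) • P + ENNReal.ofReal ε • Q)
        A).toReal)
      (∑ i, (Measure.pi (fun j => if j = i then Q else P) A).toReal
        - Fintype.card ι * (Measure.pi (fun _ : ι => P) A).toReal) (Set.Icc 0 1) 0 := by
  have hprob (s : Finset ι) (i : ι) : IsProbabilityMeasure (if i ∈ s then Q else P) := by
    split_ifs <;> infer_instance
  let c (s : Finset ι) : ℝ := (Measure.pi (fun i => if i ∈ s then Q else P) A).toReal
  have hexp : ∀ ε ∈ Set.Icc (0 : ℝ) 1,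
      ((Measure.pi fun _ : ι => ENNReal.ofReal (1 - ε) • P + ENNReal.ofReal ε • Q) A).toReal =
        ∑ s : Finset ι, ε ^ s.card * (1 - ε) ^ (Fintype.card ι - s.card) * c s := by
    rintro ε ⟨h0, h1⟩
    rw [pi_smul_add_smul P Q ENNReal.ofReal_ne_top ENNReal.ofReal_ne_top,
      Measure.finsetSum_apply, ENNReal.toReal_sum]
    · refine Finset.sum_congr rfl fun s _ => ?_
      simp [c, ENNReal.toReal_ofReal h0, ENNReal.toReal_ofReal (sub_nonneg.2 h1)]
    · intro s _
      rw [Measure.smul_apply, smul_eq_mul]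
      finiteness
  have hderiv := HasDerivAt.fun_sum (u := Finset.univ) fun (s : Finset ι) _ =>
    (hasDerivAt_pow_mul_one_sub_pow s.card (Fintype.card ι - s.card)).mul_const (c s)
  refine (hderiv.hasDerivWithinAt.congr hexp (hexp 0 (by simp))).congr_deriv ?_
  simp only [sub_mul, ite_mul, one_mul, zero_mul, Finset.sum_sub_distrib, Finset.card_eq_zero]
  congr 1
  · rw [← Finset.sum_filter, Finset.univ_filter_card_eq, Finset.powersetCard_one,
      Finset.sum_map]
    simp [c]
  · simp [c]

/-- Conditioning on the `i`-th coordinate of the chi-square statistic. -/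
theorem pi_one_contamination_apply (n : ℕ) (i : Fin (n + 1)) (μ t : ℝ) {σ : ℝ} (hσ : 0 < σ)
    {v : NNReal} (hv : (v : ℝ) = σ ^ 2) (F : Measure ℝ) [IsProbabilityMeasure F] :
    (Measure.pi (fun j => if j = i then F else gaussianReal μ v)
        {z | t < ∑ j, ((z j - μ) / σ) ^ 2}).toReal =
      ∫ x, (chiSqMeasure n (Set.Ioi (t - ((x - μ) / σ) ^ 2))).toReal ∂F := by
  have hprob (j : Fin (n + 1)) : IsProbabilityMeasure (if j = i then F else gaussianReal μ v) := by
    split_ifs <;> infer_instance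
  have hS : MeasurableSet {p : ℝ × ℝ | t < ((p.1 - μ) / σ) ^ 2 + p.2} :=
    measurableSet_lt (by fun_prop) (by fun_prop)
  have hmeas : Measurable fun z : Fin n → ℝ => ∑ j, ((z j - μ) / σ) ^ 2 := by fun_prop
  have hsec (x : ℝ) : Prod.mk x ⁻¹' {p : ℝ × ℝ | t < ((p.1 - μ) / σ) ^ 2 + p.2} =
      Set.Ioi (t - ((x - μ) / σ) ^ 2) := by
    ext y
    simp [sub_lt_iff_lt_add']
  have hmp := measurePreserving_piFinSuccAbove
    (fun j => if j = i then F else gaussianReal μ v) i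
  simp only [if_true, Fin.succAbove_ne, if_false] at hmp
  have hset : {z : Fin (n + 1) → ℝ | t < ∑ j, ((z j - μ) / σ) ^ 2} =
      MeasurableEquiv.piFinSuccAbove (fun _ => ℝ) i ⁻¹'
        (Prod.map id (fun z : Fin n → ℝ => ∑ j, ((z j - μ) / σ) ^ 2) ⁻¹'
          {p : ℝ × ℝ | t < ((p.1 - μ) / σ) ^ 2 + p.2}) := by
    ext z
    simp [Fin.sum_univ_succAbove _ i, Fin.removeNth]
  rw [hset, hmp.measure_preimage_equiv, ← Measure.map_apply (by fun_prop) hS,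
    ← Measure.map_prod_map _ _ measurable_id hmeas, Measure.map_id,
    map_sum_sq_pi_gaussianReal n μ hσ hv, Measure.prod_apply hS,
    ← integral_toReal (measurable_measure_prodMk_left hS).aemeasurable (by simp)]
  simp_rw [hsec]

theorem pi_gaussianReal_sum_sq_gt (m : ℕ) (μ t : ℝ) {σ : ℝ} (hσ : 0 < σ) {v : NNReal}
    (hv : (v : ℝ) = σ ^ 2) :
    Measure.pi (fun _ : Fin m => gaussianReal μ v) {z | t < ∑ i, ((z i - μ) / σ) ^ 2} =
      chiSqMeasure m (Set.Ioi t) := by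
  rw [← map_sum_sq_pi_gaussianReal m μ hσ hv, Measure.map_apply (by fun_prop) measurableSet_Ioi]
  rfl

theorem hasDerivWithinAt_chiSq_statistic (n : ℕ) (μ t : ℝ) {σ : ℝ} (hσ : 0 < σ)
    {v : NNReal} (hv : (v : ℝ) = σ ^ 2) (F : Measure ℝ) [IsProbabilityMeasure F] :
    HasDerivWithinAt
      (fun ε : ℝ =>
        ((Measure.pi fun _ : Fin (n + 1) =>
            (ENNReal.ofReal (1 - ε) • gaussianReal μ v + ENNReal.ofReal ε • F))
          {z | t < ∑ i, ((z i - μ) / σ) ^ 2}).toReal)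
      (((n + 1 : ℕ) : ℝ) * (∫ x, (chiSqMeasure n (Set.Ioi (t - ((x - μ) / σ) ^ 2))).toReal ∂F)
        - ((n + 1 : ℕ) : ℝ) * (chiSqMeasure (n + 1) (Set.Ioi t)).toReal)
      (Set.Icc 0 1) 0 := by
  refine (hasDerivWithinAt_pi_mixture (gaussianReal μ v) F _).congr_deriv ?_
  simp_rw [pi_one_contamination_apply n _ μ t hσ hv F]
  rw [pi_gaussianReal_sum_sq_gt (n + 1) μ t hσ hv]
  simp

theorem stmt2 (g : ℕ) (hg : 1 ≤ g) (μ σ t : ℝ) (hσ : 0 < σ)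
    (F : Measure ℝ) [IsProbabilityMeasure F] :
    HasDerivWithinAt
      (fun ε : ℝ =>
        ((Measure.pi fun _ : Fin g =>
            (ENNReal.ofReal (1 - ε) • gaussianReal μ ⟨σ ^ 2, sq_nonneg σ⟩
              + ENNReal.ofReal ε • F))
          {z | t < ∑ i, ((z i - μ) / σ) ^ 2}).toReal)
      ((g : ℝ) * (∫ x, ((chiSqMeasure (g - 1))
            (Set.Ioi (t - ((x - μ) / σ) ^ 2))).toReal ∂F)
        - (g : ℝ) * ((chiSqMeasure g) (Set.Ioi t)).toReal)
      (Set.Icc 0 1) 0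
    ∧
    ((Measure.pi fun _ : Fin g =>
        (ENNReal.ofReal (1 - (0 : ℝ)) • gaussianReal μ ⟨σ ^ 2, sq_nonneg σ⟩
          + ENNReal.ofReal (0 : ℝ) • F))
      {z | t < ∑ i, ((z i - μ) / σ) ^ 2}).toReal
      + ((g : ℝ) * (∫ x, ((chiSqMeasure (g - 1))
            (Set.Ioi (t - ((x - μ) / σ) ^ 2))).toReal ∂F)
        - (g : ℝ) * ((chiSqMeasure g) (Set.Ioi t)).toReal)
    = (g : ℝ) * (∫ x, ((chiSqMeasure (g - 1))
          (Set.Ioi (t - ((x - μ) / σ) ^ 2))).toReal ∂F)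
      - ((g : ℝ) - 1) * ((chiSqMeasure g) (Set.Ioi t)).toReal := by
  have hv : ((⟨σ ^ 2, sq_nonneg σ⟩ : NNReal) : ℝ) = σ ^ 2 := rfl
  obtain ⟨n, rfl⟩ : ∃ n, g = n + 1 := ⟨g - 1, by omega⟩
  refine ⟨hasDerivWithinAt_chiSq_statistic n μ t hσ hv F, ?_⟩
  have h := congrArg ENNReal.toReal (pi_gaussianReal_sum_sq_gt (n + 1) μ t hσ hv)
  simp only [sub_zero, ENNReal.ofReal_one, ENNReal.ofReal_zero, one_smul, zero_smul, add_zero]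
  rw [h]
  ring
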